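/- arXiv:2511.18986 — 4 statements merged into one kernel-verified Lean document; each statement's English description precedes it below -/
import Mathlib

section
/- Let X be a compact metric space, f : X → X a continuous map, S ⊆ X a closed set, and x ∈ X. Suppose the empirical measures μ_n(x) converge weakly to a Borel probability measure μ with μ(S) = 0. Then for every ε > 0 there exists r > 0 such that limsup_{n→∞} (1/n) ∑_{i=0}^{n−1} 𝟙_{B_r(S)}(f^i(x)) < ε; that is, x satisfies the weak slow recurrence condition with respect to S. -/
open Filter MeasureTheory

/-- For a closed null set `S`, there are a neighborhood `B_r(S)` and a continuous function
dominating its indicator whose integral is as small as desired. -/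
lemma exists_indicator_thickening_le_integral_lt
    {X : Type*} [PseudoMetricSpace X] [MeasurableSpace X] [BorelSpace X]
    {S : Set X} (hS : IsClosed S) (μ : Measure X) [IsFiniteMeasure μ] (hμS : μ S = 0)
    {ε : ℝ} (hε : 0 < ε) :
    ∃ r > (0 : ℝ), ∃ g : BoundedContinuousFunction X ℝ,
      (∀ y, (Metric.thickening r S).indicator (fun _ => (1 : ℝ)) y ≤ g y) ∧
        ∫ y, g y ∂μ < ε := by
  have hlim := tendsto_measure_thickening_of_isClosed (μ := μ)
    ⟨1, one_pos, measure_ne_top μ _⟩ hS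
  rw [hμS] at hlim
  obtain ⟨R, hR, hRpos⟩ := ((hlim.eventually_lt_const (ENNReal.ofReal_pos.2 hε)).and
    self_mem_nhdsWithin).exists
  have hr : 0 < R / 2 := half_pos hRpos
  let h := thickenedIndicator hr (Metric.thickening (R / 2) S)
  let g : BoundedContinuousFunction X ℝ :=
    BoundedContinuousFunction.ofNormedAddCommGroup (fun y => (h y : ℝ))
      (NNReal.continuous_coe.comp h.continuous) 1 fun y => by
        rw [NNReal.norm_eq]
        exact_mod_cast thickenedIndicator_le_one hr (Metric.thickening (R / 2) S) y
  refine ⟨R / 2, hr, g, fun y => ?_, ?_⟩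
  · refine Set.indicator_apply_le' (fun hy => ?_) fun _ => NNReal.coe_nonneg _
    exact (NNReal.coe_eq_one.2 (thickenedIndicator_one hr _ hy)).ge
  · have hle : ∀ y, g y ≤ (Metric.thickening R S).indicator (fun _ => (1 : ℝ)) y := by
      intro y
      by_cases hy : y ∈ Metric.thickening R S
      · rw [Set.indicator_of_mem hy]
        exact_mod_cast thickenedIndicator_le_one hr (Metric.thickening (R / 2) S) y
      · have hy' : y ∉ Metric.thickening (R / 2) (Metric.thickening (R / 2) S) := fun hmem =>
          hy (by simpa using Metric.thickening_thickening_subset (R / 2) (R / 2) S hmem)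
        rw [Set.indicator_of_notMem hy]
        exact (NNReal.coe_eq_zero.2 (thickenedIndicator_zero hr _ hy')).le
    have hmeas : MeasurableSet (Metric.thickening R S) := Metric.isOpen_thickening.measurableSet
    calc ∫ y, g y ∂μ ≤ ∫ y, (Metric.thickening R S).indicator (fun _ => (1 : ℝ)) y ∂μ :=
          integral_mono (g.integrable μ) ((integrable_const 1).indicator hmeas) hle
      _ = μ.real (Metric.thickening R S) := integral_indicator_one hmeas
      _ < ε := (ENNReal.lt_ofReal_iff_toReal_lt (measure_ne_top μ _)).1 hR

/-- If the empirical measures of `x` converge weakly to a Borel probability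
measure `μ` with `μ(S) = 0` for a closed set `S`, then `x` satisfies the weak
slow recurrence condition with respect to `S`. -/
theorem weak_slow_recurrence_of_no_atoms
    {X : Type*} [MetricSpace X] [CompactSpace X] [MeasurableSpace X] [BorelSpace X]
    (f : X → X) (hf : Continuous f) (S : Set X) (hS : IsClosed S) (x : X)
    (μ : Measure X) [IsProbabilityMeasure μ]
    (hconv : ∀ g : BoundedContinuousFunction X ℝ,
      Filter.Tendsto (fun n : ℕ => ((n : ℝ))⁻¹ *
        ∑ i ∈ Finset.range n, g (f^[i] x))
        Filter.atTop (nhds (∫ y, g y ∂μ)))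
    (hμS : μ S = 0) :
    ∀ ε > (0 : ℝ), ∃ r > (0 : ℝ),
      Filter.limsup (fun n : ℕ => ((n : ℝ))⁻¹ *
        ∑ i ∈ Finset.range n,
          Set.indicator (Metric.thickening r S) (fun _ => (1 : ℝ)) (f^[i] x))
        Filter.atTop < ε := by
  intro ε hε
  obtain ⟨r, hr, g, hg, hint⟩ := exists_indicator_thickening_le_integral_lt hS μ hμS hε
  refine ⟨r, hr, lt_of_le_of_lt ?_ hint⟩
  rw [← (hconv g).limsup_eq]
  refine limsup_le_limsup (Eventually.of_forall fun n => ?_) ?_ (hconv g).isBoundedUnder_le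
  · exact mul_le_mul_of_nonneg_left (Finset.sum_le_sum fun i _ => hg _) (by positivity)
  · refine IsBoundedUnder.isCoboundedUnder_le
      (isBoundedUnder_of ⟨0, fun n => mul_nonneg (by positivity) ?_⟩)
    exact Finset.sum_nonneg fun i _ => Set.indicator_nonneg (fun _ _ => zero_le_one) _
end

section
/- Let g : [0, ∞) → [0, ∞) be a function that is integrable on every bounded interval [0, s], and let (t_n)_{n≥1}, (T_n)_{n≥1} be sequences with 0 < t_n ≤ T_n ≤ t_{n+1} for all n, t_n → ∞, and T_n / t_n → 1 as n → ∞. Assume g vanishes almost everywhere on each interval [T_n, t_{n+1}]. Then limsup_{s→∞} (1/s) ∫₀^s g(u) du = limsup_{n→∞} (1/T_n) ∫₀^{T_n} g(u) du (as an equality in [0, ∞]). -/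
open Filter MeasureTheory

/-- A monotone sequence tending to infinity cuts a half-line into consecutive intervals, and the
index of the interval containing `s` tends to infinity with `s`. -/
lemma exists_index_tendsto_atTop {t : ℕ → ℝ} (hmono : Monotone t)
    (ht : Tendsto t atTop atTop) :
    ∃ N : ℝ → ℕ, Tendsto N atTop atTop ∧
      ∀ s, t 0 ≤ s → t (N s) ≤ s ∧ s < t (N s + 1) := by
  have h : ∀ s, ∃ n, t 0 ≤ s → t n ≤ s ∧ s < t (n + 1) := by
    intro s
    by_cases hs : t 0 ≤ s
    · have hex : ∃ n, s < t n := (ht.eventually_gt_atTop s).exists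
      classical
      obtain ⟨m, hm⟩ : ∃ m, Nat.find hex = m + 1 :=
        Nat.exists_eq_succ_of_ne_zero fun h0 => by
          have := Nat.find_spec hex
          rw [h0] at this
          exact this.not_ge hs
      refine ⟨m, fun _ => ⟨not_lt.1 (Nat.find_min hex (by omega)), ?_⟩⟩
      rw [← hm]
      exact Nat.find_spec hex
    · exact ⟨0, fun h => absurd h hs⟩
  choose N hN using h
  refine ⟨N, tendsto_atTop.2 fun k => ?_, hN⟩
  filter_upwards [eventually_ge_atTop (t k)] with s hs
  exact Nat.lt_succ_iff.1 <|
    hmono.reflect_lt (hs.trans_lt (hN s ((hmono k.zero_le).trans hs)).2)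

/-- If `g ≥ 0` is locally integrable on `[0, ∞)`, vanishes a.e. on each interval
`[Tₙ, tₙ₊₁]`, where `0 < tₙ ≤ Tₙ ≤ tₙ₊₁`, `tₙ → ∞` and `Tₙ/tₙ → 1`, then the
limsup of the continuous-time averages equals the limsup of the averages along
the sequence `(Tₙ)`, as an equality in `[0, ∞]`. -/
theorem limsup_average_eq_limsup_subsequence
    (g : ℝ → ℝ) (hg_nonneg : ∀ s : ℝ, 0 ≤ s → 0 ≤ g s)
    (hg_int : ∀ s : ℝ, 0 ≤ s → IntervalIntegrable g volume 0 s)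
    (t T : ℕ → ℝ)
    (hpos : ∀ n, 0 < t n) (htT : ∀ n, t n ≤ T n) (hTt : ∀ n, T n ≤ t (n + 1))
    (ht_top : Filter.Tendsto t Filter.atTop Filter.atTop)
    (hratio : Filter.Tendsto (fun n => T n / t n) Filter.atTop (nhds 1))
    (hvanish : ∀ n, ∀ᵐ u ∂volume, u ∈ Set.Icc (T n) (t (n + 1)) → g u = 0) :
    Filter.limsup
        (fun s : ℝ => ENNReal.ofReal (s⁻¹ * ∫ u in (0 : ℝ)..s, g u))
        Filter.atTop
      = Filter.limsup
        (fun n : ℕ => ENNReal.ofReal ((T n)⁻¹ * ∫ u in (0 : ℝ)..(T n), g u))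
        Filter.atTop := by
  have hmono : Monotone t := monotone_nat_of_le_succ fun n => (htT n).trans (hTt n)
  have hTpos : ∀ n, 0 < T n := fun n => (hpos n).trans_le (htT n)
  have hT_top : Tendsto T atTop atTop := tendsto_atTop_mono htT ht_top
  refine le_antisymm ?_ ?_
  · obtain ⟨N, hN_top, hN⟩ := exists_index_tendsto_atTop hmono ht_top
    have hint : ∀ n, ∫ u in (0 : ℝ)..t (n + 1), g u = ∫ u in (0 : ℝ)..T n, g u := by
      intro n
      have hT := hg_int _ (hTpos n).le
      have ht := hg_int _ (hpos (n + 1)).le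
      rw [← sub_eq_zero, intervalIntegral.integral_interval_sub_left ht hT]
      refine intervalIntegral.integral_zero_ae ?_
      filter_upwards [hvanish n] with u hu hmem
      rw [Set.uIoc_of_le (hTt n)] at hmem
      exact hu (Set.Ioc_subset_Icc_self hmem)
    have hratio' : Tendsto (fun n => ENNReal.ofReal (T n / t n)) atTop (nhds 1) := by
      simpa using ENNReal.tendsto_ofReal hratio
    calc limsup (fun s : ℝ => ENNReal.ofReal (s⁻¹ * ∫ u in (0 : ℝ)..s, g u)) atTop
        ≤ limsup ((fun n => ENNReal.ofReal (T n / t n) *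
            ENNReal.ofReal ((T n)⁻¹ * ∫ u in (0 : ℝ)..T n, g u)) ∘ N) atTop := by
          refine limsup_le_limsup ?_
          filter_upwards [eventually_ge_atTop (t 0)] with s hs
          obtain ⟨h1, h2⟩ := hN s hs
          have hs0 : 0 < s := (hpos 0).trans_le hs
          have hF : ∫ u in (0 : ℝ)..s, g u ≤ ∫ u in (0 : ℝ)..T (N s), g u := by
            rw [← hint]
            refine intervalIntegral.integral_mono_interval le_rfl hs0.le h2.le ?_
              (hg_int _ (hpos _).le)
            exact (ae_restrict_iff' measurableSet_Ioc).2 <|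
              ae_of_all _ fun u hu => hg_nonneg u hu.1.le
          have hF0 : 0 ≤ ∫ u in (0 : ℝ)..s, g u :=
            intervalIntegral.integral_nonneg hs0.le fun u hu => hg_nonneg u hu.1
          have hTne := (hTpos (N s)).ne'
          have htpos := hpos (N s)
          rw [Function.comp_apply,
            ← ENNReal.ofReal_mul (div_nonneg (hTpos _).le htpos.le)]
          refine ENNReal.ofReal_le_ofReal ?_
          calc s⁻¹ * ∫ u in (0 : ℝ)..s, g u
              ≤ (t (N s))⁻¹ * ∫ u in (0 : ℝ)..T (N s), g u := by gcongr
            _ = _ := by field_simp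
      _ ≤ limsup (fun n => ENNReal.ofReal (T n / t n) *
            ENNReal.ofReal ((T n)⁻¹ * ∫ u in (0 : ℝ)..T n, g u)) atTop := by
          rw [limsup_comp]
          exact limsup_le_limsup_of_le hN_top
      _ ≤ limsup (fun n => ENNReal.ofReal (T n / t n)) atTop *
            limsup (fun n => ENNReal.ofReal ((T n)⁻¹ * ∫ u in (0 : ℝ)..T n, g u)) atTop := by
          refine ENNReal.limsup_mul_le' ?_ ?_ <;> simp [hratio'.limsup_eq]
      _ = _ := by rw [hratio'.limsup_eq, one_mul]
  · rw [← Function.comp_def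
      (fun s : ℝ => ENNReal.ofReal (s⁻¹ * ∫ u in (0 : ℝ)..s, g u)) T, limsup_comp]
    exact limsup_le_limsup_of_le hT_top
end

section
/- Let x, y, z be real numbers with z² ≥ 3(x² + y²), set ρ² := x² + y², λ₊ := (−z + √(z² − 3ρ²))/5 and λ₋ := (−z − √(z² − 3ρ²))/5, and let A(x, y, z) be the 3×3 matrix with rows (−2z/5, −y/5, x/5), (3y/5, 0, 0), (−3x/5, 0, 0). Then A(x, y, z)·(ρ², 5yλ₊, −5xλ₊)ᵀ = λ₋·(ρ², 5yλ₊, −5xλ₊)ᵀ, A(x, y, z)·(ρ², 5yλ₋, −5xλ₋)ᵀ = λ₊·(ρ², 5yλ₋, −5xλ₋)ᵀ, and A(x, y, z)·(0, x, y)ᵀ = 0. -/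
open Matrix

/-- If `s ^ 2 = z ^ 2 - 3 * (x ^ 2 + y ^ 2)`, then `(x ^ 2 + y ^ 2, y * (-z + s), -x * (-z + s))`
is mapped to `(-z - s) / 5` times itself. -/
lemma mulVec_compound_Y3_of_sq_eq {x y z s : ℝ} (hs : s ^ 2 = z ^ 2 - 3 * (x ^ 2 + y ^ 2)) :
    (!![-2 * z / 5, -y / 5, x / 5;
        3 * y / 5, 0, 0;
        -3 * x / 5, 0, 0] : Matrix (Fin 3) (Fin 3) ℝ).mulVec
        ![x ^ 2 + y ^ 2, 5 * y * ((-z + s) / 5), -5 * x * ((-z + s) / 5)]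
      = ((-z - s) / 5) •
        ![x ^ 2 + y ^ 2, 5 * y * ((-z + s) / 5), -5 * x * ((-z + s) / 5)] := by
  ext i
  fin_cases i <;> simp [Matrix.mulVec, dotProduct, Fin.sum_univ_three]
  · ring
  · linear_combination (y / 5) * hs
  · linear_combination (-x / 5) * hs

/-- Eigenvectors of the second additive compound `A(x,y,z)` of the Jacobian of
`Y₃` when `z² ≥ 3(x²+y²)`: with `ρ² = x²+y²` and
`λ± = (−z ± √(z²−3ρ²))/5`, the vector `(ρ², 5yλ₊, −5xλ₊)` is an eigenvector
for `λ₋`, the vector `(ρ², 5yλ₋, −5xλ₋)` is an eigenvector for `λ₊`, and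
`(0, x, y)` is in the kernel. -/
theorem eigenvectors_compound_Y3 (x y z : ℝ)
    (h : z ^ 2 ≥ 3 * (x ^ 2 + y ^ 2)) :
    ((!![-2 * z / 5, -y / 5, x / 5;
         3 * y / 5, 0, 0;
         -3 * x / 5, 0, 0] : Matrix (Fin 3) (Fin 3) ℝ).mulVec
        ![x ^ 2 + y ^ 2,
          5 * y * ((-z + Real.sqrt (z ^ 2 - 3 * (x ^ 2 + y ^ 2))) / 5),
          -5 * x * ((-z + Real.sqrt (z ^ 2 - 3 * (x ^ 2 + y ^ 2))) / 5)]
      = ((-z - Real.sqrt (z ^ 2 - 3 * (x ^ 2 + y ^ 2))) / 5) •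
        ![x ^ 2 + y ^ 2,
          5 * y * ((-z + Real.sqrt (z ^ 2 - 3 * (x ^ 2 + y ^ 2))) / 5),
          -5 * x * ((-z + Real.sqrt (z ^ 2 - 3 * (x ^ 2 + y ^ 2))) / 5)]) ∧
    ((!![-2 * z / 5, -y / 5, x / 5;
         3 * y / 5, 0, 0;
         -3 * x / 5, 0, 0] : Matrix (Fin 3) (Fin 3) ℝ).mulVec
        ![x ^ 2 + y ^ 2,
          5 * y * ((-z - Real.sqrt (z ^ 2 - 3 * (x ^ 2 + y ^ 2))) / 5),
          -5 * x * ((-z - Real.sqrt (z ^ 2 - 3 * (x ^ 2 + y ^ 2))) / 5)]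
      = ((-z + Real.sqrt (z ^ 2 - 3 * (x ^ 2 + y ^ 2))) / 5) •
        ![x ^ 2 + y ^ 2,
          5 * y * ((-z - Real.sqrt (z ^ 2 - 3 * (x ^ 2 + y ^ 2))) / 5),
          -5 * x * ((-z - Real.sqrt (z ^ 2 - 3 * (x ^ 2 + y ^ 2))) / 5)]) ∧
    ((!![-2 * z / 5, -y / 5, x / 5;
         3 * y / 5, 0, 0;
         -3 * x / 5, 0, 0] : Matrix (Fin 3) (Fin 3) ℝ).mulVec ![0, x, y] = 0) := by
  have hs := Real.sq_sqrt (sub_nonneg.mpr h)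
  refine ⟨mulVec_compound_Y3_of_sq_eq hs, ?_, ?_⟩
  · simpa only [← sub_eq_add_neg, sub_neg_eq_add] using
      mulVec_compound_Y3_of_sq_eq ((neg_sq _).trans hs)
  · ext i
    fin_cases i <;> simp [Matrix.mulVec, dotProduct, Fin.sum_univ_three]
    ring
end

section
/- Let x, y, z be real numbers with 9z² ≥ 24(x² + y²), set ρ² := x² + y², λ₊ := (−z + √(9z² − 24ρ²))/10 and λ₋ := (−z − √(9z² − 24ρ²))/10, and let B(x, y, z) be the 3×3 matrix with rows (−2z/5, −y/5, x/5), (6y/5, z/5, 0), (−6x/5, 0, z/5). Then B(x, y, z)·(2ρ², y(10λ₊ − 2z), x(2z − 10λ₊))ᵀ = λ₋·(2ρ², y(10λ₊ − 2z), x(2z − 10λ₊))ᵀ and B(x, y, z)·(2ρ², y(10λ₋ − 2z), x(2z − 10λ₋))ᵀ = λ₊·(2ρ², y(10λ₋ − 2z), x(2z − 10λ₋))ᵀ. -/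
open Matrix

/-- An eigenvector of the second compound matrix attached to either square root `s` of
`9z² − 24(x² + y²)`. -/
theorem compound_mulVec_eq_smul {x y z s : ℝ}
    (hs : s ^ 2 = 9 * z ^ 2 - 24 * (x ^ 2 + y ^ 2)) :
    (!![-2 * z / 5, -y / 5, x / 5;
        6 * y / 5, z / 5, 0;
        -6 * x / 5, 0, z / 5] : Matrix (Fin 3) (Fin 3) ℝ).mulVec
        ![2 * (x ^ 2 + y ^ 2), y * (10 * ((-z + s) / 10) - 2 * z),
          x * (2 * z - 10 * ((-z + s) / 10))]
      = ((-z - s) / 10) •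
        ![2 * (x ^ 2 + y ^ 2), y * (10 * ((-z + s) / 10) - 2 * z),
          x * (2 * z - 10 * ((-z + s) / 10))] := by
  ext i
  fin_cases i <;> simp [Matrix.mulVec, dotProduct, Fin.sum_univ_three]
  · ring
  · linear_combination (y / 10) * hs
  · linear_combination (-x / 10) * hs

/-- Eigenvectors of the second additive compound `B(x,y,z)` of the Jacobian of
`Y₄` when `9z² ≥ 24(x²+y²)`: with `ρ² = x²+y²` and
`λ± = (−z ± √(9z²−24ρ²))/10`, the vector `(2ρ², y(10λ₊−2z), x(2z−10λ₊))` is an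
eigenvector for `λ₋`, and `(2ρ², y(10λ₋−2z), x(2z−10λ₋))` is an eigenvector for
`λ₊`. -/
theorem eigenvectors_compound_Y4 (x y z : ℝ)
    (h : 9 * z ^ 2 ≥ 24 * (x ^ 2 + y ^ 2)) :
    ((!![-2 * z / 5, -y / 5, x / 5;
         6 * y / 5, z / 5, 0;
         -6 * x / 5, 0, z / 5] : Matrix (Fin 3) (Fin 3) ℝ).mulVec
        ![2 * (x ^ 2 + y ^ 2),
          y * (10 * ((-z + Real.sqrt (9 * z ^ 2 - 24 * (x ^ 2 + y ^ 2))) / 10) - 2 * z),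
          x * (2 * z - 10 * ((-z + Real.sqrt (9 * z ^ 2 - 24 * (x ^ 2 + y ^ 2))) / 10))]
      = ((-z - Real.sqrt (9 * z ^ 2 - 24 * (x ^ 2 + y ^ 2))) / 10) •
        ![2 * (x ^ 2 + y ^ 2),
          y * (10 * ((-z + Real.sqrt (9 * z ^ 2 - 24 * (x ^ 2 + y ^ 2))) / 10) - 2 * z),
          x * (2 * z - 10 * ((-z + Real.sqrt (9 * z ^ 2 - 24 * (x ^ 2 + y ^ 2))) / 10))]) ∧
    ((!![-2 * z / 5, -y / 5, x / 5;
         6 * y / 5, z / 5, 0;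
         -6 * x / 5, 0, z / 5] : Matrix (Fin 3) (Fin 3) ℝ).mulVec
        ![2 * (x ^ 2 + y ^ 2),
          y * (10 * ((-z - Real.sqrt (9 * z ^ 2 - 24 * (x ^ 2 + y ^ 2))) / 10) - 2 * z),
          x * (2 * z - 10 * ((-z - Real.sqrt (9 * z ^ 2 - 24 * (x ^ 2 + y ^ 2))) / 10))]
      = ((-z + Real.sqrt (9 * z ^ 2 - 24 * (x ^ 2 + y ^ 2))) / 10) •
        ![2 * (x ^ 2 + y ^ 2),
          y * (10 * ((-z - Real.sqrt (9 * z ^ 2 - 24 * (x ^ 2 + y ^ 2))) / 10) - 2 * z),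
          x * (2 * z - 10 * ((-z - Real.sqrt (9 * z ^ 2 - 24 * (x ^ 2 + y ^ 2))) / 10))]) := by
  have hs := Real.sq_sqrt (sub_nonneg.mpr h)
  refine ⟨compound_mulVec_eq_smul hs, ?_⟩
  simpa only [sub_neg_eq_add, ← sub_eq_add_neg] using
    compound_mulVec_eq_smul ((neg_sq _).trans hs)
end
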